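/- arXiv:1101.1536 — 7 statements merged into one kernel-verified Lean document; each statement's English description precedes it below -/
import Mathlib

section
/- Suppose A is a set of pairs (a,b) of elements of {1,…,n} with a>b. If A satisfies (I1) (transitivity) and (I2) (if b<c<a and (a,b)∈A then (a,c)∈A or (c,b)∈A), then there exists a permutation σ of {1,…,n} such that A = I(σ). -/
/-- The inversion set of a permutation `σ` of `Fin n`: pairs `(a, b)` with `a > b`
such that `a` precedes `b` in the word `σ(1) σ(2) ⋯ σ(n)`, i.e. `σ⁻¹ a < σ⁻¹ b`. -/
def InvSet (n : ℕ) (σ : Equiv.Perm (Fin n)) : Set (Fin n × Fin n) :=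
  {p | p.2 < p.1 ∧ σ.symm p.1 < σ.symm p.2}

/-- `A` is the inversion set of some permutation of `Fin n`. -/
def IsInvSet (n : ℕ) (A : Set (Fin n × Fin n)) : Prop :=
  ∃ σ : Equiv.Perm (Fin n), A = InvSet n σ

/-- Condition (I1): `A` is transitive. -/
def CondI1 {n : ℕ} (A : Set (Fin n × Fin n)) : Prop :=
  ∀ a b c : Fin n, (a, b) ∈ A → (b, c) ∈ A → (a, c) ∈ A

/-- Condition (I2): if `b < c < a` and `(a, b) ∈ A`, then `(a, c) ∈ A` or `(c, b) ∈ A`. -/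
def CondI2 {n : ℕ} (A : Set (Fin n × Fin n)) : Prop :=
  ∀ a b c : Fin n, b < c → c < a → (a, b) ∈ A → (a, c) ∈ A ∨ (c, b) ∈ A

/-- Condition (I2)*: if `b < c < a` and `(a, b) ∈ A`, then `(c, b) ∈ A`. -/
def CondI2Star {n : ℕ} (A : Set (Fin n × Fin n)) : Prop :=
  ∀ a b c : Fin n, b < c → c < a → (a, b) ∈ A → (c, b) ∈ A

/-- A bracketing function on `Fin n`: (E1) `k ≤ E k`, and
(E2) if `k ≤ j ≤ E k` then `E j ≤ E k`. -/
def IsBracketing {n : ℕ} (E : Fin n → Fin n) : Prop :=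
  (∀ k, k ≤ E k) ∧ ∀ k j, k ≤ j → j ≤ E k → E j ≤ E k

/-- The set of pairs `I_E = {(a, k) : k < a ≤ E k}` associated to a bracketing function. -/
def IE {n : ℕ} (E : Fin n → Fin n) : Set (Fin n × Fin n) :=
  {p | p.2 < p.1 ∧ p.1 ≤ E p.2}

/-- The transitive closure of a set of pairs. -/
def TrCl {n : ℕ} (A : Set (Fin n × Fin n)) : Set (Fin n × Fin n) :=
  {p | Relation.TransGen (fun a b => (a, b) ∈ A) p.1 p.2}

/-- Every strict linear order on `Fin n` is the pullback of `<` along a permutation. -/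
theorem exists_perm_lt_iff_of_strict_linear {n : ℕ} (r : Fin n → Fin n → Prop)
    (irrefl : ∀ a, ¬ r a a) (trans : ∀ a b c, r a b → r b c → r a c)
    (total : ∀ a b, a ≠ b → r a b ∨ r b a) :
    ∃ e : Equiv.Perm (Fin n), ∀ a b, r a b ↔ e a < e b := by
  classical
  have card_lt (a : Fin n) : (Finset.univ.filter fun y => r y a).card < n := by
    have h : (Finset.univ.filter fun y => r y a) ⊂ Finset.univ :=
      Finset.filter_ssubset.mpr ⟨a, Finset.mem_univ a, irrefl a⟩
    simpa using Finset.card_lt_card h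
  let f : Fin n → Fin n := fun a => ⟨(Finset.univ.filter fun y => r y a).card, card_lt a⟩
  have mono (a b : Fin n) (hab : r a b) : f a < f b := by
    refine Fin.mk_lt_mk.mpr (Finset.card_lt_card ?_)
    refine (Finset.ssubset_iff_of_subset fun y hy => ?_).mpr ⟨a, by simpa, by simpa using irrefl a⟩
    simp only [Finset.mem_filter, Finset.mem_univ, true_and] at hy ⊢
    exact trans y a b hy hab
  have inj : Function.Injective f := fun a b hab => by
    by_contra hne
    rcases total a b hne with h | h
    · exact (mono a b h).ne hab
    · exact (mono b a h).ne hab.symm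
  refine ⟨Equiv.ofBijective f (Finite.injective_iff_bijective.mp inj), fun a b => ⟨mono a b, ?_⟩⟩
  intro (hab : f a < f b)
  rcases eq_or_ne a b with rfl | hne
  · exact absurd hab (lt_irrefl _)
  · exact (total a b hne).resolve_right fun h => (mono b a h).asymm hab

/-- A set of pairs `(a, b)` with `a > b` satisfying (I1) and (I2) is the inversion set
of some permutation. -/
theorem stmt_1 (n : ℕ) (A : Set (Fin n × Fin n)) (hpairs : ∀ p ∈ A, p.2 < p.1)
    (h1 : CondI1 A) (h2 : CondI2 A) :
    ∃ σ : Equiv.Perm (Fin n), A = InvSet n σ := by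
  have hlt (a b : Fin n) (h : (a, b) ∈ A) : b < a := hpairs _ h
  obtain ⟨e, he⟩ := exists_perm_lt_iff_of_strict_linear
    (fun x y : Fin n => (x, y) ∈ A ∨ (x < y ∧ (y, x) ∉ A))
    (fun a => by grind)
    (fun a b c hab hbc => by
      rcases hab with hab | ⟨hab, hba⟩ <;> rcases hbc with hbc | ⟨hbc, hcb⟩
      · exact Or.inl (h1 a b c hab hbc)
      · rcases lt_trichotomy a c with h | rfl | h
        · exact Or.inr ⟨h, fun hca => hcb (h1 c a b hca hab)⟩
        · exact absurd hab hcb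
        · exact Or.inl ((h2 a b c hbc h hab).resolve_right hcb)
      · rcases lt_trichotomy a c with h | rfl | h
        · exact Or.inr ⟨h, fun hca => hba (h1 b c a hbc hca)⟩
        · exact absurd hbc hba
        · exact Or.inl ((h2 b c a h hab hbc).resolve_left hba)
      · exact Or.inr ⟨hab.trans hbc, fun hca => (h2 c a b hab hbc hca).elim hcb hba⟩)
    (fun a b hne => by grind)
  refine ⟨e.symm, Set.ext fun ⟨a, b⟩ => ?_⟩
  simp only [InvSet, Set.mem_ofPred_eq, Equiv.symm_symm, ← he]
  grind
end

section
/- Let A₁ = I(σ₁) and A₂ = I(σ₂) be inversion sets of two permutations of {1,…,n}. Then the transitive closure (A₁ ∪ A₂)^tr of their union satisfies conditions (I1) and (I2), and hence is itself the inversion set of a permutation; consequently (A₁ ∪ A₂)^tr is the join A₁ ∨ A₂ in the permutation lattice Sₙ, i.e. the smallest inversion set containing both A₁ and A₂. -/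
theorem InvSet.condI1 {n : ℕ} (σ : Equiv.Perm (Fin n)) : CondI1 (InvSet n σ) :=
  fun _ _ _ hab hbc => ⟨hbc.1.trans hab.1, hab.2.trans hbc.2⟩

theorem InvSet.condI2 {n : ℕ} (σ : Equiv.Perm (Fin n)) : CondI2 (InvSet n σ) := by
  intro a b c hbc hca hab
  rcases lt_or_ge (σ.symm a) (σ.symm c) with h | h
  · exact Or.inl ⟨hca, h⟩
  · exact Or.inr ⟨hbc, h.trans_lt hab.2⟩

theorem CondI2.union {n : ℕ} {A B : Set (Fin n × Fin n)} (hA : CondI2 A) (hB : CondI2 B) :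
    CondI2 (A ∪ B) := by
  rintro a b c hbc hca (h | h)
  · exact (hA a b c hbc hca h).imp Or.inl Or.inl
  · exact (hB a b c hbc hca h).imp Or.inr Or.inr

theorem TrCl.condI1 {n : ℕ} (A : Set (Fin n × Fin n)) : CondI1 (TrCl A) :=
  fun _ _ _ hab hbc => Relation.TransGen.trans hab hbc

theorem subset_trCl {n : ℕ} (A : Set (Fin n × Fin n)) : A ⊆ TrCl A :=
  fun _ hp => Relation.TransGen.single hp

theorem trCl_subset {n : ℕ} {A C : Set (Fin n × Fin n)} (hC : CondI1 C) (hAC : A ⊆ C) :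
    TrCl A ⊆ C := by
  rintro ⟨a, b⟩ h
  change Relation.TransGen (fun a b => (a, b) ∈ A) a b at h
  induction h with
  | single h => exact hAC h
  | tail _ h ih => exact hC _ _ _ ih (hAC h)

theorem CondI2.trCl {n : ℕ} {A : Set (Fin n × Fin n)} (hA : CondI2 A) : CondI2 (TrCl A) := by
  intro a b c hbc hca hab
  change Relation.TransGen (fun a b => (a, b) ∈ A) a b at hab
  induction hab using Relation.TransGen.head_induction_on with
  | single h =>
    exact (hA _ _ _ hbc hca h).imp (fun h => subset_trCl A h) (fun h => subset_trCl A h)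
  | @head a d had hdb ih =>
    rcases lt_trichotomy c d with hcd | rfl | hdc
    · exact (ih hcd).imp (fun h => Relation.TransGen.head had h) id
    · exact Or.inr hdb
    · exact (hA _ _ _ hdc hca had).imp (fun h => subset_trCl A h)
        (fun h => Relation.TransGen.head h hdb)

/-- Every strict linear order on `Fin n` lists the elements in the order of some permutation. -/
theorem exists_perm_symm_lt_iff {n : ℕ} (r : Fin n → Fin n → Prop) (irrefl : ∀ a, ¬ r a a)
    (trans : ∀ a b c, r a b → r b c → r a c) (total : ∀ a b, a ≠ b → r a b ∨ r b a) :
    ∃ σ : Equiv.Perm (Fin n), ∀ a b, σ.symm a < σ.symm b ↔ r a b := by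
  classical
  have hcard (a : Fin n) : (Finset.univ.filter (r · a)).card < n := by
    have h : (Finset.univ.filter (r · a)) ⊂ Finset.univ :=
      Finset.filter_ssubset.2 ⟨a, Finset.mem_univ a, irrefl a⟩
    simpa using Finset.card_lt_card h
  let rank (a : Fin n) : Fin n := ⟨(Finset.univ.filter (r · a)).card, hcard a⟩
  have hlt {a b : Fin n} (hab : r a b) : rank a < rank b := by
    refine Fin.mk_lt_mk.2 (Finset.card_lt_card ?_)
    rw [Finset.ssubset_iff_of_subset
      (fun x hx => by simpa using trans x a b (by simpa using hx) hab)]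
    exact ⟨a, by simpa using hab, by simpa using irrefl a⟩
  have hinj : Function.Injective rank := by
    intro a b hab
    by_contra hne
    rcases total a b hne with h | h
    · exact (hlt h).ne hab
    · exact (hlt h).ne hab.symm
  refine ⟨(Equiv.ofBijective rank (Finite.injective_iff_bijective.1 hinj)).symm, fun a b => ?_⟩
  change rank a < rank b ↔ r a b
  refine ⟨fun h => ?_, hlt⟩
  rcases total a b (fun hab => h.ne (congrArg rank hab)) with h' | h'
  · exact h'
  · exact absurd (hlt h') h.asymm

/-- Conditions (I1) and (I2) characterise inversion sets among sets of pairs `(a, b)`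
with `a > b`. -/
theorem isInvSet_of_condI1_of_condI2 {n : ℕ} {A : Set (Fin n × Fin n)}
    (hlt : ∀ a b, (a, b) ∈ A → b < a) (h1 : CondI1 A) (h2 : CondI2 A) : IsInvSet n A := by
  obtain ⟨σ, hσ⟩ := exists_perm_symm_lt_iff
    (fun a b => (a < b ∧ (b, a) ∉ A) ∨ (a, b) ∈ A)
    (by grind)
    (by
      rintro a b c (⟨hab, hba⟩ | hab) (⟨hbc, hcb⟩ | hbc)
      · exact Or.inl ⟨hab.trans hbc, fun h => (h2 c a b hab hbc h).elim hcb hba⟩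
      · rcases lt_trichotomy a c with h | rfl | h
        · exact Or.inl ⟨h, fun hca => hba (h1 _ _ _ hbc hca)⟩
        · exact absurd hbc hba
        · exact Or.inr ((h2 b c a h hab hbc).resolve_left hba)
      · rcases lt_trichotomy a c with h | rfl | h
        · exact Or.inl ⟨h, fun hca => hcb (h1 _ _ _ hca hab)⟩
        · exact absurd hab hcb
        · exact Or.inr ((h2 a b c hbc h hab).resolve_right hcb)
      · exact Or.inr (h1 _ _ _ hab hbc))
    (by grind)
  refine ⟨σ, Set.ext fun ⟨a, b⟩ => ?_⟩
  change _ ↔ b < a ∧ σ.symm a < σ.symm b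
  rw [hσ]
  exact ⟨fun h => ⟨hlt a b h, Or.inr h⟩, fun h => h.2.resolve_left fun h' => h.1.asymm h'.1⟩

/-- The transitive closure of the union of two inversion sets satisfies (I1) and (I2),
hence is an inversion set, and is the smallest inversion set containing both, i.e. the
join in the permutation lattice `Sₙ`. -/
theorem stmt_2 (n : ℕ) (σ₁ σ₂ : Equiv.Perm (Fin n)) :
    CondI1 (TrCl (InvSet n σ₁ ∪ InvSet n σ₂)) ∧
    CondI2 (TrCl (InvSet n σ₁ ∪ InvSet n σ₂)) ∧
    IsInvSet n (TrCl (InvSet n σ₁ ∪ InvSet n σ₂)) ∧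
    InvSet n σ₁ ⊆ TrCl (InvSet n σ₁ ∪ InvSet n σ₂) ∧
    InvSet n σ₂ ⊆ TrCl (InvSet n σ₁ ∪ InvSet n σ₂) ∧
    ∀ C : Set (Fin n × Fin n), IsInvSet n C → InvSet n σ₁ ⊆ C → InvSet n σ₂ ⊆ C →
      TrCl (InvSet n σ₁ ∪ InvSet n σ₂) ⊆ C := by
  have hU : CondI2 (TrCl (InvSet n σ₁ ∪ InvSet n σ₂)) :=
    ((InvSet.condI2 σ₁).union (InvSet.condI2 σ₂)).trCl
  have hlt : TrCl (InvSet n σ₁ ∪ InvSet n σ₂) ⊆ {p | p.2 < p.1} :=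
    trCl_subset (fun a b c (hab : b < a) (hbc : c < b) => hbc.trans hab)
      (Set.union_subset (fun _ h => h.1) (fun _ h => h.1))
  refine ⟨TrCl.condI1 _, hU,
    isInvSet_of_condI1_of_condI2 (fun _ _ h => hlt h) (TrCl.condI1 _) hU,
    Set.subset_union_left.trans (subset_trCl _), Set.subset_union_right.trans (subset_trCl _), ?_⟩
  rintro _ ⟨τ, rfl⟩ h₁ h₂
  exact trCl_subset (InvSet.condI1 τ) (Set.union_subset h₁ h₂)
end

section
/- For every bracketing function E on {1,…,n}, the set I_E = {(a,k) : k < a ≤ E(k)} satisfies conditions (I1) (transitivity) and (I2) (if b<c<a and (a,b)∈I_E then (a,c)∈I_E or (c,b)∈I_E); in particular I_E is the inversion set of some permutation of {1,…,n}. -/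
/-- Every injective key into a linear order is strictly sorted by some permutation. -/
lemma exists_perm_symm_lt_iff_s3 {n : ℕ} {α : Type*} [LinearOrder α] (f : Fin n → α)
    (hf : Function.Injective f) :
    ∃ σ : Equiv.Perm (Fin n), ∀ a b, σ.symm a < σ.symm b ↔ f a < f b := by
  have hs : StrictMono (f ∘ Tuple.sort f) :=
    (Tuple.monotone_sort f).strictMono_of_injective (hf.comp (Tuple.sort f).injective)
  refine ⟨Tuple.sort f, fun a b => ?_⟩
  rw [← hs.lt_iff_lt]
  simp

lemma condI1_IE {n : ℕ} {E : Fin n → Fin n} (hE : IsBracketing E) : CondI1 (IE E) := by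
  rintro a b c ⟨hba, haE⟩ ⟨hcb, hbE⟩
  exact ⟨hcb.trans hba, haE.trans (hE.2 c b hcb.le hbE)⟩

lemma condI2Star_IE {n : ℕ} (E : Fin n → Fin n) : CondI2Star (IE E) :=
  fun _ _ _ hbc hca h => ⟨hbc, hca.le.trans h.2⟩

/-- The permutation listing `Fin n` by increasing `E k`, ties broken by decreasing `k`,
has inversion set `IE E`. -/
lemma isInvSet_IE {n : ℕ} {E : Fin n → Fin n} (hE : IsBracketing E) : IsInvSet n (IE E) := by
  obtain ⟨σ, hσ⟩ := exists_perm_symm_lt_iff_s3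
    (fun k => toLex (E k, OrderDual.toDual k))
    (fun a b h => by simpa using congrArg (fun x => (ofLex x).2) h)
  refine ⟨σ, Set.ext fun ⟨a, b⟩ => and_congr_right fun (hba : b < a) => ?_⟩
  rw [hσ, Prod.Lex.toLex_lt_toLex]
  simp only [OrderDual.toDual_lt_toDual, hba, and_true, ← le_iff_lt_or_eq]
  exact ⟨hE.2 b a hba.le, (hE.1 a).trans⟩

/-- For every bracketing function `E`, the set `I_E` satisfies (I1) and (I2);
in particular it is the inversion set of some permutation. -/
theorem stmt_3 (n : ℕ) (E : Fin n → Fin n) (hE : IsBracketing E) :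
    CondI1 (IE E) ∧ CondI2 (IE E) ∧ IsInvSet n (IE E) :=
  ⟨condI1_IE hE, fun a b c hbc hca h => Or.inr (condI2Star_IE E a b c hbc hca h), isInvSet_IE hE⟩
end

section
/- Let I be the inversion set of a permutation of {1,…,n} (equivalently, a set of pairs (a,b) with a>b satisfying (I1) and (I2)) which moreover satisfies (I2)*: if b<c<a and (a,b)∈I then (c,b)∈I. Then there exists a bracketing function E on {1,…,n} such that I = I_E. -/
/-- The set `{k} ∪ {a | (a, k) ∈ I}` has a greatest element. -/
theorem exists_greatest_section {n : ℕ} (I : Set (Fin n × Fin n)) (k : Fin n) :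
    ∃ m, k ≤ m ∧ (m = k ∨ (m, k) ∈ I) ∧ ∀ a, (a, k) ∈ I → a ≤ m := by
  obtain ⟨m, hm, hmax⟩ := Set.exists_max_image {a | a = k ∨ (a, k) ∈ I} id
    (Set.toFinite _) ⟨k, Or.inl rfl⟩
  exact ⟨m, hmax k (Or.inl rfl), hm, fun a ha => hmax a (Or.inr ha)⟩

/-- A transitive set of decreasing pairs satisfying (I2)* comes from a bracketing function. -/
theorem CondI1.exists_bracketing {n : ℕ} {I : Set (Fin n × Fin n)} (htrans : CondI1 I)
    (hlt : ∀ a b, (a, b) ∈ I → b < a) (hstar : CondI2Star I) :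
    ∃ E : Fin n → Fin n, IsBracketing E ∧ I = IE E := by
  choose E hle hmem hmax using exists_greatest_section I
  have key : ∀ a k, k < a → a ≤ E k → (a, k) ∈ I := by
    intro a k hka hak
    rcases hmem k with h | h
    · exact absurd (h ▸ hak) hka.not_ge
    · rcases hak.eq_or_lt with rfl | hak
      · exact h
      · exact hstar _ _ _ hka hak h
  refine ⟨E, ⟨hle, fun k j hkj hjE => ?_⟩, ?_⟩
  · rcases hkj.eq_or_lt with rfl | hkj
    · exact le_rfl
    · rcases hmem j with h | h
      · exact h.trans_le hjE
      · exact hmax k _ (htrans _ _ _ h (key j k hkj hjE))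
  · ext ⟨a, k⟩
    exact ⟨fun h => ⟨hlt a k h, hmax k a h⟩, fun h => key a k h.1 h.2⟩

/-- An inversion set of a permutation that satisfies (I2)* is of the form `I_E`
for some bracketing function `E`. -/
theorem stmt_8 (n : ℕ) (I : Set (Fin n × Fin n)) (hI : IsInvSet n I)
    (hstar : CondI2Star I) :
    ∃ E : Fin n → Fin n, IsBracketing E ∧ I = IE E := by
  obtain ⟨σ, rfl⟩ := hI
  exact (InvSet.condI1 σ).exists_bracketing (fun _ _ h => h.1) hstar
end

section
/- Let E be a bracketing function on {1,…,n} with I_E nonempty. Then there exists a bracketing function F on {1,…,n} such that I_F is obtained from I_E by removing exactly one pair, i.e. I_F = I_E \ {(E(j), j)} for some j with E(j) > j; consequently I_F is covered by I_E in the permutation lattice Sₙ. -/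
/-- If `j` is the largest non-fixed point of a bracketing function `E`, lowering `E j` by one
gives a bracketing function. -/
theorem IsBracketing.update_of_fixed_above {n : ℕ} {E : Fin n → Fin n} (hE : IsBracketing E)
    {j m : Fin n} (hjm : j ≤ m) (hm : m.val + 1 = (E j).val) (hfix : ∀ k, j < k → E k = k) :
    IsBracketing (Function.update E j m) := by
  obtain ⟨h1, h2⟩ := hE
  refine ⟨fun k => ?_, fun k i hki hik => ?_⟩
  · rcases eq_or_ne k j with rfl | hk
    · simpa using hjm
    · simpa [hk] using h1 k
  · rcases eq_or_ne k j with rfl | hk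
    · rcases eq_or_ne i k with rfl | hi
      · simp
      · simp only [Function.update_self, Function.update_of_ne hi] at hik ⊢
        rwa [hfix i (lt_of_le_of_ne hki hi.symm)]
    · rw [Function.update_of_ne hk] at hik ⊢
      have hEi := h2 k i hki hik
      rcases eq_or_ne i j with rfl | hi
      · rw [Function.update_self]
        omega
      · rwa [Function.update_of_ne hi]

/-- Lowering one value of `E` by one removes exactly one pair from `IE E`. -/
theorem IE_update {n : ℕ} (E : Fin n → Fin n) {j m : Fin n} (hm : m.val + 1 = (E j).val) :
    IE (Function.update E j m) = IE E \ {(E j, j)} := by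
  ext ⟨a, k⟩
  simp only [IE, Set.mem_ofPred_eq, Set.mem_sdiff, Set.mem_singleton_iff, Prod.mk.injEq]
  rcases eq_or_ne k j with rfl | hk
  · simp only [Function.update_self, and_true]
    omega
  · simp [hk]

/-- For a bracketing function `E` with `I_E` nonempty, there is a bracketing function `F`
with `I_F = I_E \ {(E j, j)}` for some `j` with `E j > j`; consequently `I_F` is covered
by `I_E` in the permutation lattice `Sₙ`. -/
theorem stmt_9 (n : ℕ) (E : Fin n → Fin n) (hE : IsBracketing E) (hne : IE E ≠ ∅) :
    ∃ (F : Fin n → Fin n) (j : Fin n), IsBracketing F ∧ j < E j ∧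
      IE F = IE E \ {(E j, j)} ∧
      IE F ⊆ IE E ∧ IE F ≠ IE E ∧
      ∀ C : Set (Fin n × Fin n), IsInvSet n C → IE F ⊆ C → C ⊆ IE E →
        C = IE F ∨ C = IE E := by
  classical
  obtain ⟨⟨a, k⟩, hka, haE⟩ := Set.nonempty_iff_ne_empty.mpr hne
  obtain ⟨j, hj, hmax⟩ :=
    (Set.toFinite {k | k < E k}).exists_maximal ⟨k, lt_of_lt_of_le hka haE⟩
  replace hj : j < E j := hj
  have hfix : ∀ k, j < k → E k = k := fun k hk =>
    (eq_of_le_of_not_lt (hE.1 k) fun h => (hmax h hk.le).not_gt hk).symm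
  obtain ⟨m, hm⟩ : ∃ m : Fin n, m.val + 1 = (E j).val :=
    ⟨⟨(E j).val - 1, by omega⟩, by simp only; omega⟩
  have hmem : (E j, j) ∈ IE E := ⟨hj, le_rfl⟩
  have hIE := IE_update E hm
  refine ⟨Function.update E j m, j, hE.update_of_fixed_above (by omega) hm hfix, hj, hIE, ?_⟩
  rw [hIE]
  refine ⟨Set.sdiff_subset, fun h => ?_, fun C _ hFC hCE => ?_⟩
  · rw [← h] at hmem
    exact hmem.2 rfl
  · by_cases hC : (E j, j) ∈ C
    · refine Or.inr (hCE.antisymm fun p hp => ?_)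
      by_cases hpj : p = (E j, j)
      · exact hpj ▸ hC
      · exact hFC ⟨hp, hpj⟩
    · exact Or.inl (Set.Subset.antisymm (fun p hp => ⟨hCE hp, fun h => hC (h ▸ hp)⟩) hFC)
end

section
/- If E is a bracketing function on {1,…,n}, E(j) > j for some j, and j is chosen among such indices so that E(j) − j is minimal, then E(k) = k for every k with j < k < E(j), and the function F defined by F(i) = E(i) for i ≠ j and F(j) = E(j) − 1 is again a bracketing function. -/
/-- If `E` is a bracketing function, `E j > j`, and `E j − j` is minimal among such
indices, then `E k = k` for all `j < k < E j`, and the function obtained from `E` by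
decreasing the value at `j` by one is again a bracketing function. -/
theorem stmt_10 (n : ℕ) (E : Fin n → Fin n) (hE : IsBracketing E) (j : Fin n)
    (hj : j < E j)
    (hmin : ∀ i : Fin n, i < E i → (E j : ℕ) - (j : ℕ) ≤ (E i : ℕ) - (i : ℕ)) :
    (∀ k : Fin n, j < k → k < E j → E k = k) ∧
    ∀ F : Fin n → Fin n, (∀ i, i ≠ j → F i = E i) → ((F j : ℕ) = (E j : ℕ) - 1) →
      IsBracketing F := by
  obtain ⟨h1, h2⟩ := hE
  have hfix : ∀ k : Fin n, j < k → k < E j → E k = k := by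
    intro k hjk hkj
    by_contra hne
    have hlt : k < E k := lt_of_le_of_ne (h1 k) (Ne.symm hne)
    have hmin_k := hmin k hlt
    have hle := h2 j k hjk.le hkj.le
    omega
  refine ⟨hfix, fun F hF hFj => ⟨fun k => ?_, fun k i hki hik => ?_⟩⟩
  · by_cases hk : k = j
    · subst hk
      omega
    · rw [hF k hk]
      exact h1 k
  · by_cases hk : k = j
    · subst hk
      by_cases hi : i = k
      · rw [hi]
      · rw [hF i hi, hfix i (lt_of_le_of_ne hki (Ne.symm hi)) (by omega)]
        exact hik
    · rw [hF k hk] at hik ⊢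
      have hle := h2 k i hki hik
      by_cases hi : i = j
      · subst hi
        omega
      · rw [hF i hi]
        exact hle
end

section
/- A finite direct product of permutation lattices is a sublattice of another permutation lattice; in particular, for all m and n the product lattice S_m × S_n admits a lattice embedding (an injective map preserving binary meets and joins) into S_{m+n}. -/
/-- `M` is the meet of `A` and `B` in the permutation lattice `Sₙ`: the largest
inversion set contained in both. -/
def IsMeetS (n : ℕ) (A B M : Set (Fin n × Fin n)) : Prop :=
  IsInvSet n M ∧ M ⊆ A ∧ M ⊆ B ∧
    ∀ C : Set (Fin n × Fin n), IsInvSet n C → C ⊆ A → C ⊆ B → C ⊆ M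

/-- `J` is the join of `A` and `B` in the permutation lattice `Sₙ`: the smallest
inversion set containing both. -/
def IsJoinS (n : ℕ) (A B J : Set (Fin n × Fin n)) : Prop :=
  IsInvSet n J ∧ A ⊆ J ∧ B ⊆ J ∧
    ∀ C : Set (Fin n × Fin n), IsInvSet n C → A ⊆ C → B ⊆ C → J ⊆ C

/-- An injective map `h` into a linear order determines an inversion set, namely that of the
permutation listing `Fin n` in increasing order of `h`. -/
theorem isInvSet_of_injective {n : ℕ} {α : Type*} [LinearOrder α] {h : Fin n → α}
    (hh : Function.Injective h) : IsInvSet n {p | p.2 < p.1 ∧ h p.1 < h p.2} := by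
  have hm : StrictMono (h ∘ Tuple.sort h) :=
    (Tuple.monotone_sort h).strictMono_of_injective (hh.comp (Tuple.sort h).injective)
  refine ⟨Tuple.sort h, ?_⟩
  ext ⟨a, b⟩
  have hab := hm.lt_iff_lt (a := (Tuple.sort h).symm a) (b := (Tuple.sort h).symm b)
  simp only [Function.comp_apply, Equiv.apply_symm_apply] at hab
  simp [InvSet, hab]

/-- Inversion sets restrict along strictly monotone maps. -/
theorem IsInvSet.preimage {k n : ℕ} {C : Set (Fin n × Fin n)} (hC : IsInvSet n C)
    {g : Fin k → Fin n} (hg : StrictMono g) : IsInvSet k (Prod.map g g ⁻¹' C) := by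
  obtain ⟨σ, rfl⟩ := hC
  convert isInvSet_of_injective (σ.symm.injective.comp hg.injective) using 1
  ext ⟨a, b⟩
  simp [InvSet, hg.lt_iff_lt]

/-- The union of a relation on the first `m` elements of `Fin (m + n)` and a relation on the
last `n` elements. -/
def blockSum {m n : ℕ} (p : Set (Fin m × Fin m) × Set (Fin n × Fin n)) :
    Set (Fin (m + n) × Fin (m + n)) :=
  Prod.map (Fin.castAdd n) (Fin.castAdd n) '' p.1 ∪ Prod.map (Fin.natAdd m) (Fin.natAdd m) '' p.2

section blockSum

variable {m n : ℕ}

theorem preimage_castAdd_blockSum (p : Set (Fin m × Fin m) × Set (Fin n × Fin n)) :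
    Prod.map (Fin.castAdd n) (Fin.castAdd n) ⁻¹' blockSum p = p.1 := by
  ext ⟨a, b⟩
  simp only [blockSum, Set.mem_preimage, Set.mem_union, Set.mem_image, Prod.exists, Prod.map_apply,
    Prod.mk.injEq, Fin.ext_iff, Fin.val_castAdd, Fin.val_natAdd]
  constructor
  · rintro (⟨c, d, h, hc, hd⟩ | ⟨c, d, h, hc, hd⟩)
    · rwa [← Fin.ext hc, ← Fin.ext hd]
    · omega
  · exact fun h => Or.inl ⟨a, b, h, rfl, rfl⟩

theorem preimage_natAdd_blockSum (p : Set (Fin m × Fin m) × Set (Fin n × Fin n)) :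
    Prod.map (Fin.natAdd m) (Fin.natAdd m) ⁻¹' blockSum p = p.2 := by
  ext ⟨a, b⟩
  simp only [blockSum, Set.mem_preimage, Set.mem_union, Set.mem_image, Prod.exists, Prod.map_apply,
    Prod.mk.injEq, Fin.ext_iff, Fin.val_castAdd, Fin.val_natAdd, Nat.add_left_cancel_iff]
  constructor
  · rintro (⟨c, d, h, hc, hd⟩ | ⟨c, d, h, hc, hd⟩)
    · omega
    · rwa [← Fin.ext hc, ← Fin.ext hd]
  · exact fun h => Or.inr ⟨a, b, h, rfl, rfl⟩

theorem blockSum_injective :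
    Function.Injective (blockSum : Set (Fin m × Fin m) × Set (Fin n × Fin n) → _) := by
  intro p q h
  apply Prod.ext
  · rw [← preimage_castAdd_blockSum p, h, preimage_castAdd_blockSum]
  · rw [← preimage_natAdd_blockSum p, h, preimage_natAdd_blockSum]

theorem blockSum_mono {p q : Set (Fin m × Fin m) × Set (Fin n × Fin n)} (h₁ : p.1 ⊆ q.1)
    (h₂ : p.2 ⊆ q.2) : blockSum p ⊆ blockSum q :=
  Set.union_subset_union (Set.image_mono h₁) (Set.image_mono h₂)

theorem blockSum_subset_iff {p : Set (Fin m × Fin m) × Set (Fin n × Fin n)}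
    {C : Set (Fin (m + n) × Fin (m + n))} :
    blockSum p ⊆ C ↔ p.1 ⊆ Prod.map (Fin.castAdd n) (Fin.castAdd n) ⁻¹' C ∧
      p.2 ⊆ Prod.map (Fin.natAdd m) (Fin.natAdd m) ⁻¹' C := by
  rw [blockSum, Set.union_subset_iff, Set.image_subset_iff, Set.image_subset_iff]

/-- A relation below a block sum is the block sum of its two restrictions. -/
theorem blockSum_preimage_of_subset {p : Set (Fin m × Fin m) × Set (Fin n × Fin n)}
    {C : Set (Fin (m + n) × Fin (m + n))} (h : C ⊆ blockSum p) :
    blockSum (Prod.map (Fin.castAdd n) (Fin.castAdd n) ⁻¹' C,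
      Prod.map (Fin.natAdd m) (Fin.natAdd m) ⁻¹' C) = C := by
  refine (blockSum_subset_iff.2 ⟨subset_rfl, subset_rfl⟩).antisymm fun x hx => ?_
  rcases h hx with ⟨y, -, rfl⟩ | ⟨y, -, rfl⟩
  · exact Or.inl ⟨y, hx, rfl⟩
  · exact Or.inr ⟨y, hx, rfl⟩

theorem IsInvSet.blockSum {p : Set (Fin m × Fin m) × Set (Fin n × Fin n)}
    (h₁ : IsInvSet m p.1) (h₂ : IsInvSet n p.2) : IsInvSet (m + n) (blockSum p) := by
  obtain ⟨A, B⟩ := p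
  obtain ⟨σ, rfl⟩ := h₁
  obtain ⟨τ, rfl⟩ := h₂
  convert isInvSet_of_injective
    (toLex.injective.comp ((Equiv.sumCongr σ.symm τ.symm).injective.comp
      finSumFinEquiv.symm.injective)) using 1
  ext ⟨a, b⟩
  induction a using Fin.addCases with
  | left a =>
    induction b using Fin.addCases with
    | left b =>
      refine (Set.ext_iff.1 (preimage_castAdd_blockSum (InvSet m σ, InvSet n τ)) (a, b)).trans ?_
      simp [InvSet, (Fin.strictMono_castAdd n).lt_iff_lt]
    | right b =>
      refine iff_of_false ?_ fun h => ?_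
      · rintro (⟨⟨c, d⟩, -, h⟩ | ⟨⟨c, d⟩, -, h⟩) <;>
          simp only [Prod.map_apply, Prod.mk.injEq, Fin.ext_iff, Fin.val_castAdd,
            Fin.val_natAdd] at h <;> omega
      · have := Fin.lt_def.1 h.1
        simp only [Fin.val_castAdd, Fin.val_natAdd] at this
        omega
  | right a =>
    induction b using Fin.addCases with
    | left b =>
      refine iff_of_false ?_ fun h => ?_
      · rintro (⟨⟨c, d⟩, -, h⟩ | ⟨⟨c, d⟩, -, h⟩) <;>
          simp only [Prod.map_apply, Prod.mk.injEq, Fin.ext_iff, Fin.val_castAdd,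
            Fin.val_natAdd] at h <;> omega
      · simpa using h.2
    | right b =>
      refine (Set.ext_iff.1 (preimage_natAdd_blockSum (InvSet m σ, InvSet n τ)) (a, b)).trans ?_
      simp [InvSet]

end blockSum

/-- The product `S_m × S_n` (with componentwise lattice structure) admits a lattice
embedding into `S_{m+n}`: an injective map on pairs of inversion sets, landing in
inversion sets, which sends componentwise meets to meets and componentwise joins to
joins. -/
theorem stmt_18 (m n : ℕ) :
    ∃ f : Set (Fin m × Fin m) × Set (Fin n × Fin n) → Set (Fin (m + n) × Fin (m + n)),
      (∀ p, IsInvSet m p.1 → IsInvSet n p.2 → IsInvSet (m + n) (f p)) ∧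
      (∀ p q, IsInvSet m p.1 → IsInvSet n p.2 → IsInvSet m q.1 → IsInvSet n q.2 →
        f p = f q → p = q) ∧
      (∀ A₁ B₁ M₁ A₂ B₂ M₂,
        IsInvSet m A₁ → IsInvSet m B₁ → IsInvSet n A₂ → IsInvSet n B₂ →
        IsMeetS m A₁ B₁ M₁ → IsMeetS n A₂ B₂ M₂ →
        IsMeetS (m + n) (f (A₁, A₂)) (f (B₁, B₂)) (f (M₁, M₂))) ∧
      (∀ A₁ B₁ J₁ A₂ B₂ J₂,
        IsInvSet m A₁ → IsInvSet m B₁ → IsInvSet n A₂ → IsInvSet n B₂ →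
        IsJoinS m A₁ B₁ J₁ → IsJoinS n A₂ B₂ J₂ →
        IsJoinS (m + n) (f (A₁, A₂)) (f (B₁, B₂)) (f (J₁, J₂))) := by
  refine ⟨blockSum, fun p h₁ h₂ => h₁.blockSum h₂,
    fun p q _ _ _ _ h => blockSum_injective h, ?_, ?_⟩
  · rintro A₁ B₁ M₁ A₂ B₂ M₂ - - - - ⟨hM₁, hA₁, hB₁, h₁⟩ ⟨hM₂, hA₂, hB₂, h₂⟩
    refine ⟨hM₁.blockSum hM₂, blockSum_mono hA₁ hA₂, blockSum_mono hB₁ hB₂,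
      fun C hC hCA hCB => ?_⟩
    rw [← blockSum_preimage_of_subset hCA]
    apply blockSum_mono
    · refine h₁ _ (hC.preimage (Fin.strictMono_castAdd n)) ?_ ?_
      · exact (Set.preimage_mono hCA).trans (preimage_castAdd_blockSum _).subset
      · exact (Set.preimage_mono hCB).trans (preimage_castAdd_blockSum _).subset
    · refine h₂ _ (hC.preimage (Fin.strictMono_natAdd m)) ?_ ?_
      · exact (Set.preimage_mono hCA).trans (preimage_natAdd_blockSum _).subset
      · exact (Set.preimage_mono hCB).trans (preimage_natAdd_blockSum _).subset
  · rintro A₁ B₁ J₁ A₂ B₂ J₂ - - - - ⟨hJ₁, hA₁, hB₁, h₁⟩ ⟨hJ₂, hA₂, hB₂, h₂⟩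
    refine ⟨hJ₁.blockSum hJ₂, blockSum_mono hA₁ hA₂, blockSum_mono hB₁ hB₂,
      fun C hC hCA hCB => ?_⟩
    rw [blockSum_subset_iff] at hCA hCB ⊢
    exact ⟨h₁ _ (hC.preimage (Fin.strictMono_castAdd n)) hCA.1 hCB.1,
      h₂ _ (hC.preimage (Fin.strictMono_natAdd m)) hCA.2 hCB.2⟩
end
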